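/- Let c > 2, let m ≥ 3 be an integer, and let p, q ∈ [0,1] with p ≤ 1/2 and mp ≥ c. Then ℓ1(Bin(m,p), Bin(m,q)) ≥ (1/350) · min( √m |p−q| / √(p(1−p)), 1 ). -/

import Mathlib

/-- The probability mass function of the binomial distribution `Bin(m,p)` at `j`. -/
noncomputable def binomPMF (m : ℕ) (p : ℝ) (j : ℕ) : ℝ :=
  (m.choose j : ℝ) * p ^ j * (1 - p) ^ (m - j)

/-- The ℓ1 distance between the binomial distributions `Bin(m,p)` and `Bin(m,q)`. -/
noncomputable def binomL1 (m : ℕ) (p q : ℝ) : ℝ :=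
  ∑ j ∈ Finset.range (m + 1), |binomPMF m p j - binomPMF m q j|

theorem binomPMF_eq_eval_bernsteinPolynomial (m : ℕ) (p : ℝ) (j : ℕ) :
    binomPMF m p j = (bernsteinPolynomial ℝ m j).eval p := by
  simp [binomPMF, bernsteinPolynomial]

theorem binomPMF_nonneg (m : ℕ) {p : ℝ} (hp0 : 0 ≤ p) (hp1 : p ≤ 1) (j : ℕ) :
    0 ≤ binomPMF m p j := by
  have : 0 ≤ 1 - p := by linarith
  unfold binomPMF
  positivity

theorem sum_binomPMF (m : ℕ) (p : ℝ) : ∑ j ∈ Finset.range (m + 1), binomPMF m p j = 1 := by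
  have h := congrArg (Polynomial.eval p) (bernsteinPolynomial.sum ℝ m)
  simpa [Polynomial.eval_finsetSum, binomPMF_eq_eval_bernsteinPolynomial] using h

theorem sum_mul_binomPMF (m : ℕ) (p : ℝ) :
    ∑ j ∈ Finset.range (m + 1), (j : ℝ) * binomPMF m p j = m * p := by
  have h := congrArg (Polynomial.eval p) (bernsteinPolynomial.sum_smul ℝ m)
  simpa [Polynomial.eval_finsetSum, binomPMF_eq_eval_bernsteinPolynomial] using h

/-- The second moment of the binomial distribution about an arbitrary point `a`. -/
theorem sum_sub_sq_mul_binomPMF (m : ℕ) (p a : ℝ) :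
    ∑ j ∈ Finset.range (m + 1), ((j : ℝ) - a) ^ 2 * binomPMF m p j =
      m * p * (1 - p) + (m * p - a) ^ 2 := by
  have hv : ∑ j ∈ Finset.range (m + 1), (m * p - (j : ℝ)) ^ 2 * binomPMF m p j =
      m * p * (1 - p) := by
    have h := congrArg (Polynomial.eval p) (bernsteinPolynomial.variance ℝ m)
    simpa [Polynomial.eval_finsetSum, binomPMF_eq_eval_bernsteinPolynomial] using h
  have hsplit : ∀ j ∈ Finset.range (m + 1), ((j : ℝ) - a) ^ 2 * binomPMF m p j =
      (m * p - (j : ℝ)) ^ 2 * binomPMF m p j + 2 * (m * p - a) * ((j : ℝ) * binomPMF m p j) +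
        ((m * p - a) ^ 2 - 2 * (m * p - a) * (m * p)) * binomPMF m p j := by
    intro j _
    ring
  rw [Finset.sum_congr rfl hsplit, Finset.sum_add_distrib, Finset.sum_add_distrib,
    ← Finset.mul_sum, ← Finset.mul_sum, hv, sum_mul_binomPMF, sum_binomPMF]
  ring

/-- The expectation of `f` under `Bin(m,p)`. -/
noncomputable def binomExp (m : ℕ) (f : ℕ → ℝ) (p : ℝ) : ℝ :=
  ∑ j ∈ Finset.range (m + 1), f j * binomPMF m p j

theorem abs_binomExp_sub_le_binomL1 (m : ℕ) (f : ℕ → ℝ) (hf : ∀ j, |f j| ≤ 1) (p q : ℝ) :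
    |binomExp m f p - binomExp m f q| ≤ binomL1 m p q := by
  unfold binomExp binomL1
  rw [← Finset.sum_sub_distrib]
  refine (Finset.abs_sum_le_sum_abs _ _).trans (Finset.sum_le_sum fun j _ => ?_)
  rw [← mul_sub, abs_mul]
  exact mul_le_of_le_one_left (abs_nonneg _) (hf j)

/-- Differentiating a binomial expectation in the success probability gives the expected forward
difference under one trial fewer. -/
theorem hasDerivAt_binomExp (n : ℕ) (f : ℕ → ℝ) (p : ℝ) :
    HasDerivAt (binomExp (n + 1) f)
      ((n + 1) * binomExp n (fun j => f (j + 1) - f j) p) p := by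
  have hterm (j : ℕ) : HasDerivAt (fun s => f j * binomPMF (n + 1) s j)
      (f j * (Polynomial.derivative (bernsteinPolynomial ℝ (n + 1) j)).eval p) p := by
    simp only [binomPMF_eq_eval_bernsteinPolynomial]
    exact ((bernsteinPolynomial ℝ (n + 1) j).hasDerivAt p).const_mul _
  have h := HasDerivAt.fun_sum (u := Finset.range (n + 1 + 1)) fun j _ => hterm j
  refine h.congr_deriv ?_
  have hshift : ∑ j ∈ Finset.range (n + 1), f (j + 1) * binomPMF n p (j + 1) +
      f 0 * binomPMF n p 0 = ∑ j ∈ Finset.range (n + 1), f j * binomPMF n p j := by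
    rw [← Finset.sum_range_succ' (fun j => f j * binomPMF n p j), Finset.sum_range_succ]
    simp [binomPMF]
  have hsucc : ∀ j ∈ Finset.range (n + 1),
      f (j + 1) * (Polynomial.derivative (bernsteinPolynomial ℝ (n + 1) (j + 1))).eval p =
        (n + 1) * (f (j + 1) * binomPMF n p j) -
          (n + 1) * (f (j + 1) * binomPMF n p (j + 1)) := by
    intro j _
    rw [bernsteinPolynomial.derivative_succ_aux]
    simp only [binomPMF_eq_eval_bernsteinPolynomial, Polynomial.eval_mul, Polynomial.eval_add,
      Polynomial.eval_sub, Polynomial.eval_natCast, Polynomial.eval_one]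
    ring
  rw [Finset.sum_range_succ', Finset.sum_congr rfl hsucc, Finset.sum_sub_distrib,
    ← Finset.mul_sum, ← Finset.mul_sum, bernsteinPolynomial.derivative_zero]
  simp only [binomExp, sub_mul, Finset.sum_sub_distrib, ← hshift]
  simp [binomPMF_eq_eval_bernsteinPolynomial]
  ring

theorem binomExp_nonneg (m : ℕ) {f : ℕ → ℝ} (hf : ∀ j, 0 ≤ f j) {p : ℝ} (hp0 : 0 ≤ p)
    (hp1 : p ≤ 1) : 0 ≤ binomExp m f p :=
  Finset.sum_nonneg fun j _ => mul_nonneg (hf j) (binomPMF_nonneg m hp0 hp1 j)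

theorem continuous_binomExp (n : ℕ) (f : ℕ → ℝ) : Continuous (binomExp (n + 1) f) :=
  continuous_iff_continuousAt.2 fun p => (hasDerivAt_binomExp n f p).continuousAt

theorem differentiable_binomExp (n : ℕ) (f : ℕ → ℝ) : Differentiable ℝ (binomExp (n + 1) f) :=
  fun p => (hasDerivAt_binomExp n f p).differentiableAt

theorem monotoneOn_binomExp (n : ℕ) {f : ℕ → ℝ} (hf : ∀ j, f j ≤ f (j + 1)) :
    MonotoneOn (binomExp (n + 1) f) (Set.Icc 0 1) := by
  refine monotoneOn_of_deriv_nonneg (convex_Icc 0 1) (continuous_binomExp n f).continuousOn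
    (differentiable_binomExp n f).differentiableOn fun s hs => ?_
  have hs' := interior_subset hs
  rw [(hasDerivAt_binomExp n f s).deriv]
  exact mul_nonneg (by positivity)
    (binomExp_nonneg n (fun j => sub_nonneg.2 (hf j)) hs'.1 hs'.2)

/-- The truncation to `[-1,1]` of the linear function with zero `a` and slope `1 / (5 * σ)`. -/
noncomputable def truncLinear (a σ : ℝ) (j : ℕ) : ℝ :=
  max (-1) (min 1 (((j : ℝ) - a) / (5 * σ)))

theorem abs_truncLinear_le_one (a σ : ℝ) (j : ℕ) : |truncLinear a σ j| ≤ 1 :=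
  abs_le.2 ⟨le_max_left _ _, max_le (by norm_num) (min_le_left _ _)⟩

theorem truncLinear_le_succ (a : ℝ) {σ : ℝ} (hσ : 0 < σ) (j : ℕ) :
    truncLinear a σ j ≤ truncLinear a σ (j + 1) := by
  unfold truncLinear
  gcongr
  simp

theorem le_truncLinear_succ_sub (a : ℝ) {σ : ℝ} (hσ : 1 ≤ σ) (j : ℕ) :
    1 / (5 * σ) * (1 - ((j : ℝ) - a) ^ 2 / (16 * σ ^ 2)) ≤
      truncLinear a σ (j + 1) - truncLinear a σ j := by
  have hσ0 : 0 < σ := by linarith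
  by_cases h : |(j : ℝ) - a| ≤ 4 * σ
  · obtain ⟨h1, h2⟩ := abs_le.1 h
    have e1 : truncLinear a σ j = ((j : ℝ) - a) / (5 * σ) := by
      unfold truncLinear
      rw [min_eq_right ((div_le_one (by positivity)).2 (by linarith)),
        max_eq_right ((le_div_iff₀ (by positivity)).2 (by linarith))]
    have e2 : truncLinear a σ (j + 1) = ((j : ℝ) + 1 - a) / (5 * σ) := by
      unfold truncLinear
      push_cast
      rw [min_eq_right ((div_le_one (by positivity)).2 (by linarith)),
        max_eq_right ((le_div_iff₀ (by positivity)).2 (by linarith))]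
    have e3 : truncLinear a σ (j + 1) - truncLinear a σ j = 1 / (5 * σ) := by
      rw [e1, e2]
      ring
    rw [e3]
    exact mul_le_of_le_one_right (by positivity) (sub_le_self _ (by positivity))
  · have hsq : 16 * σ ^ 2 ≤ ((j : ℝ) - a) ^ 2 := by
      rw [← sq_abs ((j : ℝ) - a)]
      nlinarith
    have hle : 1 - ((j : ℝ) - a) ^ 2 / (16 * σ ^ 2) ≤ 0 :=
      sub_nonpos.2 ((one_le_div (by positivity)).2 hsq)
    exact (mul_nonpos_of_nonneg_of_nonpos (by positivity) hle).trans
      (sub_nonneg.2 (truncLinear_le_succ a hσ0 j))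

theorem second_moment_le {n : ℕ} {p σ s : ℝ} (hp0 : 0 ≤ p) (hp1 : p ≤ 1) (hσ : 1 ≤ σ)
    (hvar : σ ^ 2 = (n + 1) * p * (1 - p)) (hs0 : 0 ≤ s) (hs1 : s ≤ 1)
    (hsp : |(n + 1) * (s - p)| ≤ σ) :
    n * s * (1 - s) + (n * s - (n + 1) * p) ^ 2 ≤ 6 * σ ^ 2 := by
  have hbias : |n * s - (n + 1) * p| ≤ 2 * σ := by
    obtain ⟨h1, h2⟩ := abs_le.1 hsp
    exact abs_le.2 ⟨by linarith, by linarith⟩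
  have hbias_sq : (n * s - (n + 1) * p) ^ 2 ≤ (2 * σ) ^ 2 :=
    sq_le_sq' (abs_le.1 hbias).1 (abs_le.1 hbias).2
  have hdiff : (n + 1) * (s - p) * (1 - s - p) ≤ σ := by
    refine (le_abs_self _).trans ?_
    rw [abs_mul]
    exact (mul_le_of_le_one_right (abs_nonneg _)
      (abs_le.2 ⟨by linarith, by linarith⟩)).trans hsp
  nlinarith [mul_nonneg hs0 (sub_nonneg.2 hs1)]

theorem le_binomExp_forward_difference {n : ℕ} {p σ s : ℝ} (hp0 : 0 ≤ p) (hp1 : p ≤ 1)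
    (hσ : 1 ≤ σ) (hvar : σ ^ 2 = (n + 1) * p * (1 - p)) (hs0 : 0 ≤ s) (hs1 : s ≤ 1)
    (hsp : |(n + 1) * (s - p)| ≤ σ) :
    1 / (8 * σ) ≤ binomExp n (fun j => truncLinear ((n + 1) * p) σ (j + 1) -
      truncLinear ((n + 1) * p) σ j) s := by
  have hσ0 : 0 < σ := by linarith
  have hsum : ∑ j ∈ Finset.range (n + 1),
      1 / (5 * σ) * (1 - ((j : ℝ) - (n + 1) * p) ^ 2 / (16 * σ ^ 2)) * binomPMF n s j =
      1 / (5 * σ) * (1 - (n * s * (1 - s) + (n * s - (n + 1) * p) ^ 2) / (16 * σ ^ 2)) := by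
    rw [← sum_sub_sq_mul_binomPMF, Finset.sum_div, ← sum_binomPMF n s, ← Finset.sum_sub_distrib,
      Finset.mul_sum]
    refine Finset.sum_congr rfl fun j _ => ?_
    rw [sum_binomPMF]
    ring
  calc 1 / (8 * σ) = 1 / (5 * σ) * (1 - 6 * σ ^ 2 / (16 * σ ^ 2)) := by
        field_simp
        norm_num
    _ ≤ 1 / (5 * σ) *
          (1 - (n * s * (1 - s) + (n * s - (n + 1) * p) ^ 2) / (16 * σ ^ 2)) := by
        gcongr
        exact second_moment_le hp0 hp1 hσ hvar hs0 hs1 hsp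
    _ ≤ _ := by
        rw [← hsum]
        exact Finset.sum_le_sum fun j _ => mul_le_mul_of_nonneg_right
          (le_truncLinear_succ_sub _ hσ j) (binomPMF_nonneg n hs0 hs1 j)

/-- A function monotone on `[0,1]` which grows at rate at least `κ` within distance `δ` of `p`
separates `p` from every `q` by at least `κ * min |p - q| δ`. -/
theorem mul_min_le_abs_sub {g : ℝ → ℝ} (hg : Differentiable ℝ g)
    (hmono : MonotoneOn g (Set.Icc 0 1)) {p q κ δ : ℝ} (hδ : 0 ≤ δ)
    (hp : p ∈ Set.Icc (0 : ℝ) 1) (hq : q ∈ Set.Icc (0 : ℝ) 1)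
    (hderiv : ∀ s ∈ Set.Icc (0 : ℝ) 1, |s - p| ≤ δ → κ ≤ deriv g s) :
    κ * min |p - q| δ ≤ |g p - g q| := by
  have hgrow : ∀ x ∈ Set.Icc (max 0 (p - δ)) (min 1 (p + δ)),
      ∀ y ∈ Set.Icc (max 0 (p - δ)) (min 1 (p + δ)), x ≤ y → κ * (y - x) ≤ g y - g x := by
    refine (convex_Icc _ _).mul_sub_le_image_sub_of_le_deriv hg.continuous.continuousOn
      hg.differentiableOn fun s hs => ?_
    obtain ⟨h1, h2⟩ := interior_subset hs
    obtain ⟨h3, h4⟩ := max_le_iff.1 h1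
    obtain ⟨h5, h6⟩ := le_min_iff.1 h2
    exact hderiv s ⟨h3, h5⟩ (abs_le.2 ⟨by linarith, by linarith⟩)
  obtain ⟨hp0, hp1⟩ := hp
  obtain ⟨hq0, hq1⟩ := hq
  have hpI : p ∈ Set.Icc (max 0 (p - δ)) (min 1 (p + δ)) :=
    ⟨max_le hp0 (by linarith), le_min hp1 (by linarith)⟩
  have hd0 : 0 ≤ min |p - q| δ := le_min (abs_nonneg _) hδ
  have hd1 := min_le_left |p - q| δ
  have hd2 := min_le_right |p - q| δ
  set d := min |p - q| δ
  rcases le_total p q with hpq | hpq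
  · rw [abs_of_nonpos (sub_nonpos.2 hpq)] at hd1
    have h1 := hgrow p hpI (p + d)
      ⟨max_le (by linarith) (by linarith), le_min (by linarith) (by linarith)⟩ (by linarith)
    have h2 := hmono (a := p + d) (b := q) ⟨by linarith, by linarith⟩ ⟨hq0, hq1⟩ (by linarith)
    rw [add_sub_cancel_left] at h1
    linarith [neg_abs_le (g p - g q)]
  · rw [abs_of_nonneg (sub_nonneg.2 hpq)] at hd1
    have h1 := hgrow (p - d)
      ⟨max_le (by linarith) (by linarith), le_min (by linarith) (by linarith)⟩ p hpI (by linarith)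
    have h2 := hmono (a := q) (b := p - d) ⟨hq0, hq1⟩ ⟨by linarith, by linarith⟩ (by linarith)
    rw [sub_sub_cancel] at h1
    linarith [le_abs_self (g p - g q)]

theorem div_eight_mul_min_le_binomL1 {n : ℕ} {p q σ : ℝ} (hp0 : 0 ≤ p) (hp1 : p ≤ 1)
    (hq0 : 0 ≤ q) (hq1 : q ≤ 1) (hσ : 1 ≤ σ) (hvar : σ ^ 2 = (n + 1) * p * (1 - p)) :
    (n + 1) / (8 * σ) * min |p - q| (σ / (n + 1)) ≤ binomL1 (n + 1) p q := by
  have hσ0 : 0 < σ := by linarith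
  have hn : (0 : ℝ) < n + 1 := by positivity
  refine (mul_min_le_abs_sub (differentiable_binomExp n (truncLinear ((n + 1) * p) σ))
    (monotoneOn_binomExp n (truncLinear_le_succ _ hσ0)) (by positivity) ⟨hp0, hp1⟩ ⟨hq0, hq1⟩
    fun s hs hsp => ?_).trans
    (abs_binomExp_sub_le_binomL1 (n + 1) _ (abs_truncLinear_le_one ((n + 1) * p) σ) p q)
  have hsp' : |(n + 1) * (s - p)| ≤ σ := by
    rw [abs_mul, abs_of_pos hn, mul_comm]
    exact (le_div_iff₀ hn).1 hsp
  rw [(hasDerivAt_binomExp n _ s).deriv, ← mul_one_div]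
  exact mul_le_mul_of_nonneg_left
    (le_binomExp_forward_difference hp0 hp1 hσ hvar hs.1 hs.2 hsp') hn.le

/-- lower bound on the ℓ1 distance between binomial distributions in the
large-`mp` regime: if `c > 2`, `m ≥ 3`, `p ≤ 1/2` and `mp ≥ c`, then
`ℓ1(Bin(m,p), Bin(m,q)) ≥ (1/350) min(√m |p-q|/√(p(1-p)), 1)`. -/
theorem stmt9 (c : ℝ) (hc : 2 < c) (m : ℕ) (hm : 3 ≤ m) (p q : ℝ)
    (hp0 : 0 ≤ p) (hp1 : p ≤ 1) (hq0 : 0 ≤ q) (hq1 : q ≤ 1)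
    (hphalf : p ≤ 1 / 2) (hmp : c ≤ (m : ℝ) * p) :
    (1 / 350 : ℝ) * min (Real.sqrt m * |p - q| / Real.sqrt (p * (1 - p))) 1 ≤
      binomL1 m p q := by
  obtain ⟨n, rfl⟩ : ∃ n, m = n + 1 := ⟨m - 1, by omega⟩
  push_cast at hmp ⊢
  have hn : (0 : ℝ) < n + 1 := by positivity
  have hppos : 0 < p := hp0.lt_of_ne (by rintro rfl; linarith)
  have hτ : 0 < √(p * (1 - p)) := Real.sqrt_pos.2 (mul_pos hppos (by linarith))
  have hτsq : √(p * (1 - p)) ^ 2 = p * (1 - p) :=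
    Real.sq_sqrt (mul_nonneg hp0 (by linarith))
  have hrsq : √((n : ℝ) + 1) ^ 2 = n + 1 := Real.sq_sqrt hn.le
  have hr : 0 < √((n : ℝ) + 1) := Real.sqrt_pos.2 hn
  set τ := √(p * (1 - p))
  set r := √((n : ℝ) + 1)
  have hvar : (r * τ) ^ 2 = (n + 1) * p * (1 - p) := by
    rw [mul_pow, hτsq, hrsq]
    ring
  have hσ : 1 ≤ r * τ := by
    rw [← one_le_sq_iff₀ (by positivity), hvar]
    nlinarith
  refine le_trans ?_ (div_eight_mul_min_le_binomL1 hp0 hp1 hq0 hq1 hσ hvar)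
  have hmin : (n + 1) / (8 * (r * τ)) * min |p - q| (r * τ / (n + 1)) =
      1 / 8 * min (r * |p - q| / τ) 1 := by
    rw [mul_min_of_nonneg _ _ (by positivity), mul_min_of_nonneg _ _ (by norm_num), ← hrsq]
    congr 1 <;> field_simp
  rw [hmin]
  gcongr
  norm_num
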